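/- arXiv:1509.07356 — 4 statements merged into one kernel-verified Lean document; each statement's English description precedes it below -/
import Mathlib

section
/- Let X be a Hausdorff topological space, let n be a natural number, and let f : X → ℝⁿ be a continuous proper map. Suppose S ⊆ X is a dense subset that is saturated by f, the image f(S) is a convex subset of ℝⁿ, for every y ∈ f(S) the fibre S ∩ f⁻¹({y}) is connected, and the corestricted map f|_S : S → f(S) is an open map (with respect to the subspace topologies). Then f(X) is a convex subset of ℝⁿ and for every y ∈ f(X) the fibre f⁻¹({y}) is connected. -/
open Set Topology in
/-- If a map restricts to an open map `S → f '' S` with preconnected fibres, then the preimage in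
`S` of a preconnected subset of `f '' S` is preconnected. -/
theorem IsPreconnected.inter_preimage_of_isOpenMap_restrict
    {X Y : Type*} [TopologicalSpace X] [TopologicalSpace Y] {f : X → Y} {S : Set X} {C : Set Y}
    (hopen : IsOpenMap (MapsTo.restrict f S (f '' S) (mapsTo_image f S)))
    (hfib : ∀ y ∈ f '' S, IsPreconnected (S ∩ f ⁻¹' {y}))
    (hC : IsPreconnected (C ∩ f '' S)) : IsPreconnected (S ∩ f ⁻¹' C) := by
  have image_open : ∀ U : Set X, IsOpen U → ∃ W : Set Y, IsOpen W ∧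
      ∀ z ∈ f '' S, (z ∈ W ↔ ∃ x ∈ S, x ∈ U ∧ f x = z) := by
    intro U hU
    obtain ⟨W, hW, hWeq⟩ := isOpen_induced_iff.mp (hopen _ (hU.preimage continuous_subtype_val))
    refine ⟨W, hW, fun z hz => ?_⟩
    have hmem := Set.ext_iff.mp hWeq ⟨z, hz⟩
    simp only [mem_preimage, mem_image, Subtype.exists] at hmem
    rw [hmem]
    constructor
    · rintro ⟨x, hxS, hxU, hx⟩
      exact ⟨x, hxS, hxU, congrArg Subtype.val hx⟩
    · rintro ⟨x, hxS, hxU, hx⟩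
      exact ⟨x, hxS, hxU, Subtype.ext hx⟩
  rintro U V hU hV hUV ⟨a, ⟨haS, haC⟩, haU⟩ ⟨b, ⟨hbS, hbC⟩, hbV⟩
  obtain ⟨W₁, hW₁, h₁⟩ := image_open U hU
  obtain ⟨W₂, hW₂, h₂⟩ := image_open V hV
  have hcover : C ∩ f '' S ⊆ W₁ ∪ W₂ := by
    rintro _ ⟨hzC, x, hxS, rfl⟩
    have hz := mem_image_of_mem f hxS
    rcases hUV ⟨hxS, hzC⟩ with hx | hx
    · exact Or.inl ((h₁ _ hz).mpr ⟨x, hxS, hx, rfl⟩)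
    · exact Or.inr ((h₂ _ hz).mpr ⟨x, hxS, hx, rfl⟩)
  have ha := mem_image_of_mem f haS
  have hb := mem_image_of_mem f hbS
  obtain ⟨z, ⟨hzC, hz⟩, hz₁, hz₂⟩ := hC W₁ W₂ hW₁ hW₂ hcover
    ⟨f a, ⟨haC, ha⟩, (h₁ _ ha).mpr ⟨a, haS, haU, rfl⟩⟩
    ⟨f b, ⟨hbC, hb⟩, (h₂ _ hb).mpr ⟨b, hbS, hbV, rfl⟩⟩
  obtain ⟨p, hpS, hpU, hp⟩ := (h₁ z hz).mp hz₁
  obtain ⟨q, hqS, hqV, hq⟩ := (h₂ z hz).mp hz₂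
  have hsub : S ∩ f ⁻¹' {z} ⊆ S ∩ f ⁻¹' C := by
    rintro x ⟨hxS, rfl⟩
    exact ⟨hxS, hzC⟩
  obtain ⟨x, hx, hxUV⟩ := hfib z hz U V hU hV (hsub.trans hUV)
    ⟨p, ⟨hpS, hp⟩, hpU⟩ ⟨q, ⟨hqS, hq⟩, hqV⟩
  exact ⟨x, hsub hx, hxUV⟩

open Set Topology in
/-- A fibre of a proper map from a Hausdorff space to a T1 space is preconnected if the point has
arbitrarily small neighbourhoods with preconnected preimage. -/
theorem IsProperMap.isPreconnected_fibre {X Y : Type*} [TopologicalSpace X] [T2Space X]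
    [TopologicalSpace Y] [T1Space Y] {f : X → Y} (hf : IsProperMap f) {y : Y}
    (hy : ∀ N ∈ 𝓝 y, ∃ B ⊆ N, y ∈ B ∧ IsPreconnected (f ⁻¹' B)) :
    IsPreconnected (f ⁻¹' {y}) := by
  have hK : IsCompact (f ⁻¹' {y}) := hf.isCompact_preimage isCompact_singleton
  rw [isPreconnected_iff_subset_of_disjoint_closed]
  intro u v hu hv huv hdisj
  obtain ⟨U, V, hU, hV, huU, hvV, hUV⟩ :
      SeparatedNhds (f ⁻¹' {y} ∩ u) (f ⁻¹' {y} ∩ v) := by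
    refine SeparatedNhds.of_isCompact_isCompact (hK.inter_right hu) (hK.inter_right hv) ?_
    rw [disjoint_iff_inter_eq_empty, ← inter_inter_distrib_left, hdisj]
  have hcover : f ⁻¹' {y} ⊆ U ∪ V := fun x hx =>
    (huv hx).imp (fun h => huU ⟨hx, h⟩) (fun h => hvV ⟨hx, h⟩)
  have hN : (f '' (U ∪ V)ᶜ)ᶜ ∈ 𝓝 y := by
    refine (hf.isClosedMap _ (hU.union hV).isClosed_compl).isOpen_compl.mem_nhds ?_
    rintro ⟨x, hx, rfl⟩
    exact hx (hcover rfl)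
  obtain ⟨B, hBN, hyB, hB⟩ := hy _ hN
  have hBUV : f ⁻¹' B ⊆ U ∪ V := fun x hx =>
    by_contra fun h => hBN hx ⟨x, h, rfl⟩
  have hyB' : f ⁻¹' {y} ⊆ f ⁻¹' B := preimage_mono (singleton_subset_iff.mpr hyB)
  rcases hB.subset_or_subset hU hV hUV hBUV with h | h
  · exact Or.inl fun x hx => (huv hx).resolve_right fun hxv =>
      hUV.notMem_of_mem_left (h (hyB' hx)) (hvV ⟨hx, hxv⟩)
  · exact Or.inr fun x hx => (huv hx).resolve_left fun hxu =>
      hUV.notMem_of_mem_left (huU ⟨hx, hxu⟩) (h (hyB' hx))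

/-- **Lemma (fibre connectedness for proper maps).**
Let `X` be a Hausdorff topological space and `f : X → ℝⁿ` a continuous proper map.
Suppose `S ⊆ X` is a dense subset saturated by `f`, the image `f(S)` is convex,
the fibres of `f|_S` are connected, and the corestriction `f|_S : S → f(S)` is open.
Then `f(X)` is convex and all fibres of `f` are connected. -/
theorem convexity_and_fibre_connectedness_of_proper_map
    {X : Type*} [TopologicalSpace X] [T2Space X] {n : ℕ}
    (f : X → EuclideanSpace ℝ (Fin n))
    (hcont : Continuous f) (hproper : IsProperMap f)
    (S : Set X) (hdense : Dense S)
    (hsat : S = f ⁻¹' (f '' S))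
    (hconv : Convex ℝ (f '' S))
    (hfib : ∀ y ∈ f '' S, IsConnected (S ∩ f ⁻¹' {y}))
    (hopen : IsOpenMap (Set.MapsTo.restrict f S (f '' S) (Set.mapsTo_image f S))) :
    Convex ℝ (Set.range f) ∧ ∀ y ∈ Set.range f, IsConnected (f ⁻¹' {y}) := by
  have hrange : Set.range f = closure (f '' S) := by
    rw [hproper.isClosedMap.closure_image_eq_of_continuous hcont, hdense.closure_eq,
      Set.image_univ]
  refine ⟨hrange ▸ hconv.closure, fun y hy => ⟨?_, ?_⟩⟩
  · obtain ⟨x, rfl⟩ := hy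
    exact ⟨x, rfl⟩
  · refine hproper.isPreconnected_fibre fun N hN => ?_
    obtain ⟨r, hr, hrN⟩ := Metric.mem_nhds_iff.mp hN
    refine ⟨Metric.ball y r, hrN, Metric.mem_ball_self hr, ?_⟩
    have hS : IsPreconnected (S ∩ f ⁻¹' Metric.ball y r) :=
      IsPreconnected.inter_preimage_of_isOpenMap_restrict hopen
        (fun z hz => (hfib z hz).isPreconnected)
        ((convex_ball y r).inter hconv).isPreconnected
    refine hS.subset_closure Set.inter_subset_right ?_
    rw [Set.inter_comm]
    exact hdense.open_subset_closure_inter (Metric.isOpen_ball.preimage hcont)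
end

section
/- Let X be a Hausdorff topological space, let n be a natural number, and let f : X → ℝⁿ be a continuous proper map. Suppose S ⊆ X is a dense subset that is saturated by f, the image f(S) is a convex subset of ℝⁿ, for every y ∈ f(S) the fibre S ∩ f⁻¹({y}) is connected, and the corestricted map f|_S : S → f(S) is an open map (with respect to the subspace topologies). Then for every y ∈ f(X) the fibre f⁻¹({y}) is connected; in particular every fibre f⁻¹({y}), y ∈ ℝⁿ, is preconnected. -/
open Set

/-- If the corestriction of `f` to `S` is open and has connected fibres, then the preimage in `S`
of a preconnected subset of `f '' S` is preconnected. -/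
theorem isPreconnected_inter_preimage_of_isOpenMap_restrict
    {X Y : Type*} [TopologicalSpace X] [TopologicalSpace Y] {f : X → Y} {S : Set X} {P : Set Y}
    (hfib : ∀ y ∈ f '' S, IsPreconnected (S ∩ f ⁻¹' {y}))
    (hopen : IsOpenMap (MapsTo.restrict f S (f '' S) (mapsTo_image f S)))
    (hP : IsPreconnected P) (hPS : P ⊆ f '' S) :
    IsPreconnected (S ∩ f ⁻¹' P) := by
  have image_open : ∀ U : Set X, IsOpen U →
      ∃ O : Set Y, IsOpen O ∧ ∀ y ∈ f '' S, y ∈ O ↔ ∃ x ∈ S, x ∈ U ∧ f x = y := by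
    intro U hU
    obtain ⟨O, hO, hOU⟩ := isOpen_induced_iff.mp
      (hopen _ (hU.preimage (continuous_subtype_val (p := (· ∈ S)))))
    refine ⟨O, hO, fun y hy => ?_⟩
    refine (Set.ext_iff.1 hOU ⟨y, hy⟩).trans ⟨?_, ?_⟩
    · rintro ⟨x, hxU, hxy⟩
      exact ⟨x, x.2, hxU, congrArg Subtype.val hxy⟩
    · rintro ⟨x, hxS, hxU, hxy⟩
      exact ⟨⟨x, hxS⟩, hxU, Subtype.ext hxy⟩
  rintro U V hU hV hcover ⟨a, ⟨haS, haP⟩, haU⟩ ⟨b, ⟨hbS, hbP⟩, hbV⟩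
  obtain ⟨A, hA, hAU⟩ := image_open U hU
  obtain ⟨B, hB, hBV⟩ := image_open V hV
  obtain ⟨y, hyP, hyA, hyB⟩ := hP A B hA hB
    (fun y hy => by
      obtain ⟨x, hxS, rfl⟩ := hPS hy
      rcases hcover ⟨hxS, hy⟩ with hx | hx
      · exact Or.inl ((hAU _ (hPS hy)).2 ⟨x, hxS, hx, rfl⟩)
      · exact Or.inr ((hBV _ (hPS hy)).2 ⟨x, hxS, hx, rfl⟩))
    ⟨f a, haP, (hAU _ (hPS haP)).2 ⟨a, haS, haU, rfl⟩⟩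
    ⟨f b, hbP, (hBV _ (hPS hbP)).2 ⟨b, hbS, hbV, rfl⟩⟩
  have hsub : S ∩ f ⁻¹' {y} ⊆ S ∩ f ⁻¹' P :=
    inter_subset_inter_right S (preimage_mono (singleton_subset_iff.2 hyP))
  obtain ⟨u, huS, huU, huy⟩ := (hAU y (hPS hyP)).1 hyA
  obtain ⟨v, hvS, hvV, hvy⟩ := (hBV y (hPS hyP)).1 hyB
  exact (hfib y (hPS hyP) U V hU hV (hsub.trans hcover)
    ⟨u, ⟨huS, huy⟩, huU⟩ ⟨v, ⟨hvS, hvy⟩, hvV⟩).mono (inter_subset_inter_left _ hsub)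

/-- A fibre of a proper map `f` from a Hausdorff space is preconnected if, for a dense set `S`,
the sets `S ∩ f ⁻¹' B` are preconnected for all balls `B` around the base point. -/
theorem IsProperMap.isPreconnected_fibre_of_dense
    {X Y : Type*} [TopologicalSpace X] [T2Space X] [MetricSpace Y] {f : X → Y}
    (hf : IsProperMap f) {S : Set X} (hS : Dense S) {y : Y}
    (hball : ∀ r > 0, IsPreconnected (S ∩ f ⁻¹' Metric.ball y r)) :
    IsPreconnected (f ⁻¹' {y}) := by
  have hK : IsCompact (f ⁻¹' {y}) := hf.isCompact_preimage isCompact_singleton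
  rw [isPreconnected_iff_subset_of_disjoint_closed]
  intro u v hu hv hcover hdisj
  have hsep : Disjoint (f ⁻¹' {y} ∩ u) (f ⁻¹' {y} ∩ v) := by
    rw [disjoint_iff_inter_eq_empty, ← inter_inter_distrib_left, hdisj]
  obtain ⟨U, V, hU, hV, huU, hvV, hUV⟩ :=
    SeparatedNhds.of_isCompact_isCompact (hK.inter_right hu) (hK.inter_right hv) hsep
  have hKUV : f ⁻¹' {y} ⊆ U ∪ V := fun x hx =>
    (hcover hx).imp (fun h => huU ⟨hx, h⟩) (fun h => hvV ⟨hx, h⟩)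
  have hclosed : IsClosed (f '' (U ∪ V)ᶜ) := hf.isClosedMap _ (hU.union hV).isClosed_compl
  have hy : y ∈ (f '' (U ∪ V)ᶜ)ᶜ := by
    rintro ⟨x, hx, hxy⟩
    exact hx (hKUV hxy)
  obtain ⟨r, hr, hrsub⟩ := Metric.isOpen_iff.1 hclosed.isOpen_compl y hy
  have meets : ∀ W : Set X, IsOpen W → ∀ x ∈ f ⁻¹' {y}, x ∈ W →
      ((S ∩ f ⁻¹' Metric.ball y r) ∩ W).Nonempty := by
    intro W hW x hx hxW
    have hxball : x ∈ f ⁻¹' Metric.ball y r := by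
      rw [mem_preimage, show f x = y from hx]
      exact Metric.mem_ball_self hr
    obtain ⟨z, ⟨hzB, hzW⟩, hzS⟩ := hS.inter_open_nonempty _
      ((Metric.isOpen_ball.preimage hf.continuous).inter hW) ⟨x, hxball, hxW⟩
    exact ⟨z, ⟨hzS, hzB⟩, hzW⟩
  by_contra! h
  obtain ⟨a, haK, hau⟩ := not_subset.1 h.1
  obtain ⟨b, hbK, hbv⟩ := not_subset.1 h.2
  obtain ⟨z, -, hzU, hzV⟩ := hball r hr U V hU hV
    (fun x hx => by_contra fun hxUV => hrsub hx.2 ⟨x, hxUV, rfl⟩)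
    (meets U hU b hbK (huU ⟨hbK, (hcover hbK).resolve_right hbv⟩))
    (meets V hV a haK (hvV ⟨haK, (hcover haK).resolve_left hau⟩))
  exact disjoint_left.1 hUV hzU hzV


/-- **Lemma (fibre connectedness for proper maps, fibre statement).**
Let `X` be a Hausdorff topological space and `f : X → ℝⁿ` a continuous proper map.
Suppose `S ⊆ X` is a dense subset saturated by `f`, the image `f(S)` is convex,
the fibres of `f|_S` are connected, and the corestriction `f|_S : S → f(S)` is open.
Then all fibres of `f` over points of `f(X)` are connected; in particular every fibre
is preconnected. -/
theorem fibre_connectedness_of_proper_map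
    {X : Type*} [TopologicalSpace X] [T2Space X] {n : ℕ}
    (f : X → EuclideanSpace ℝ (Fin n))
    (hcont : Continuous f) (hproper : IsProperMap f)
    (S : Set X) (hdense : Dense S)
    (hsat : S = f ⁻¹' (f '' S))
    (hconv : Convex ℝ (f '' S))
    (hfib : ∀ y ∈ f '' S, IsConnected (S ∩ f ⁻¹' {y}))
    (hopen : IsOpenMap (Set.MapsTo.restrict f S (f '' S) (Set.mapsTo_image f S))) :
    (∀ y ∈ Set.range f, IsConnected (f ⁻¹' {y})) ∧
      ∀ y : EuclideanSpace ℝ (Fin n), IsPreconnected (f ⁻¹' {y}) := by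
  have hpre : ∀ y, IsPreconnected (f ⁻¹' {y}) := fun y =>
    hproper.isPreconnected_fibre_of_dense hdense fun r _ => by
      have h := isPreconnected_inter_preimage_of_isOpenMap_restrict
        (fun y hy => (hfib y hy).isPreconnected) hopen
        (hconv.inter (convex_ball y r)).isPreconnected inter_subset_left
      rwa [preimage_inter, ← inter_assoc, ← hsat, inter_self] at h
  refine ⟨?_, hpre⟩
  rintro _ ⟨x, rfl⟩
  exact ⟨⟨x, rfl⟩, hpre _⟩
end

section
/- Let X be the unit sphere {(x,y,z) ∈ ℝ³ : x² + y² + z² = 1} with the subspace topology, and define f : X → ℂ by f(x,y,z) = exp(π i (z+1)). Let S = X \ {(0,0,1), (0,0,−1)}. Then: (i) f is continuous and proper; (ii) S is dense in X and saturated by f, i.e. S = f⁻¹(f(S)); (iii) the corestricted map f|_S : S → f(S) is an open map with respect to the subspace topologies; (iv) for every w ∈ f(S) the fibre S ∩ f⁻¹({w}) is connected; but (v) f(S) is not a convex subset of ℂ (regarded as ℝ²), and (vi) the fibre f⁻¹({1}) = {(0,0,1), (0,0,−1)} is not connected. -/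
/-- The unit sphere in `ℝ³`. -/
def SphereX : Set (ℝ × ℝ × ℝ) := {v | v.1 ^ 2 + v.2.1 ^ 2 + v.2.2 ^ 2 = 1}

/-- The map `f(x,y,z) = exp (π i (z + 1))` on the sphere. -/
noncomputable def fSphere : SphereX → ℂ :=
  fun v => Complex.exp (Real.pi * Complex.I * ((v.1.2.2 : ℂ) + 1))

/-- The north pole `(0,0,1)`. -/
def northPole : SphereX := ⟨(0, 0, 1), by simp [SphereX]⟩

/-- The south pole `(0,0,-1)`. -/
def southPole : SphereX := ⟨(0, 0, -1), by simp [SphereX]⟩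

/-- `S = X \ {(0,0,1), (0,0,-1)}`. -/
def SSphere : Set SphereX := Set.univ \ {northPole, southPole}

/-- The point of the sphere with longitude `θ` and latitude `φ`. -/
noncomputable def sphericalPoint (p : ℝ × ℝ) : SphereX :=
  ⟨(Real.cos p.2 * Real.cos p.1, Real.cos p.2 * Real.sin p.1, Real.sin p.2), by
    simp only [SphereX, Set.mem_ofPred_eq]
    linear_combination Real.cos p.2 ^ 2 * Real.sin_sq_add_cos_sq p.1 +
      Real.sin_sq_add_cos_sq p.2⟩

lemma continuous_sphericalPoint : Continuous sphericalPoint := by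
  unfold sphericalPoint
  fun_prop

lemma height_sq_le_one (v : SphereX) : v.1.2.2 ^ 2 ≤ 1 := by
  have h : v.1.1 ^ 2 + v.1.2.1 ^ 2 + v.1.2.2 ^ 2 = 1 := v.2
  nlinarith [sq_nonneg v.1.1, sq_nonneg v.1.2.1]

lemma exists_longitude (v : SphereX) :
    ∃ θ : ℝ, sphericalPoint (θ, Real.arcsin v.1.2.2) = v := by
  have h : v.1.1 ^ 2 + v.1.2.1 ^ 2 + v.1.2.2 ^ 2 = 1 := v.2
  obtain ⟨h₁, h₂⟩ := abs_le.mp ((sq_le_one_iff_abs_le_one _).mp (height_sq_le_one v))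
  have hr : √(1 - v.1.2.2 ^ 2) = ‖(⟨v.1.1, v.1.2.1⟩ : ℂ)‖ := by
    rw [Complex.norm_eq_sqrt_sq_add_sq]
    congr 1
    dsimp only
    linarith
  refine ⟨Complex.arg ⟨v.1.1, v.1.2.1⟩, Subtype.ext (Prod.ext ?_ (Prod.ext ?_ ?_))⟩
  · simp only [sphericalPoint, Real.cos_arcsin, hr, Complex.norm_mul_cos_arg]
  · simp only [sphericalPoint, Real.cos_arcsin, hr, Complex.norm_mul_sin_arg]
  · exact Real.sin_arcsin h₁ h₂

lemma surjective_sphericalPoint : Function.Surjective sphericalPoint := fun v =>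
  let ⟨_, hθ⟩ := exists_longitude v
  ⟨_, hθ⟩

instance : CompactSpace SphereX := by
  refine isCompact_iff_compactSpace.mp
    ((isCompact_Icc (a := ((-1, -1, -1) : ℝ × ℝ × ℝ)) (b := (1, 1, 1))).of_isClosed_subset
      (isClosed_eq (by fun_prop) continuous_const) ?_)
  rintro ⟨x, y, z⟩ h
  replace h : x ^ 2 + y ^ 2 + z ^ 2 = 1 := h
  refine ⟨⟨?_, ?_, ?_⟩, ⟨?_, ?_, ?_⟩⟩ <;> dsimp only <;> nlinarith

lemma mem_poles_iff {v : SphereX} :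
    v ∈ ({northPole, southPole} : Set SphereX) ↔ v.1.2.2 ^ 2 = 1 := by
  constructor
  · rintro (rfl | rfl) <;> simp [northPole, southPole]
  · obtain ⟨⟨x, y, z⟩, h⟩ := v
    intro hz
    replace h : x ^ 2 + y ^ 2 + z ^ 2 = 1 := h
    dsimp only at hz
    have hx : x = 0 := by nlinarith
    have hy : y = 0 := by nlinarith
    subst hx hy
    rcases eq_or_eq_neg_of_sq_eq_sq z 1 (by rw [hz, one_pow]) with rfl | rfl
    · exact Or.inl rfl
    · exact Or.inr rfl

lemma mem_SSphere_iff {v : SphereX} : v ∈ SSphere ↔ v.1.2.2 ^ 2 ≠ 1 := by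
  rw [SSphere, Set.mem_sdiff, mem_poles_iff]
  simp

lemma abs_height_lt_one {v : SphereX} (hv : v ∈ SSphere) : |v.1.2.2| < 1 :=
  (sq_lt_one_iff_abs_lt_one _).mp (lt_of_le_of_ne (height_sq_le_one v) (mem_SSphere_iff.mp hv))

lemma dense_SSphere : Dense SSphere := by
  have hcos : Dense {φ : ℝ | Real.cos φ ≠ 0} := by
    refine Set.Countable.dense_compl ℝ (s := {φ | Real.cos φ = 0})
      ((Set.countable_range fun k : ℤ => (2 * k + 1) * Real.pi / 2).mono ?_)
    intro φ hφ
    obtain ⟨k, hk⟩ := Real.cos_eq_zero_iff.mp hφ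
    exact ⟨k, hk.symm⟩
  refine (surjective_sphericalPoint.denseRange.dense_image continuous_sphericalPoint
    (dense_univ.prod hcos)).mono ?_
  rintro _ ⟨p, ⟨-, hp⟩, rfl⟩
  rw [mem_SSphere_iff]
  intro h
  replace h : Real.sin p.2 ^ 2 = 1 := h
  exact hp (pow_eq_zero_iff two_ne_zero |>.mp (by linarith [Real.sin_sq_add_cos_sq p.2]))

lemma continuous_fSphere : Continuous fSphere := by
  unfold fSphere
  fun_prop

lemma fSphere_congr {v w : SphereX} (h : v.1.2.2 = w.1.2.2) : fSphere v = fSphere w := by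
  simp only [fSphere, h]

lemma neg_fSphere (v : SphereX) :
    -fSphere v = Complex.exp ((Real.pi * v.1.2.2 : ℝ) * Complex.I) := by
  rw [fSphere, mul_add, mul_one, Complex.exp_add, Complex.exp_pi_mul_I]
  push_cast
  ring_nf

lemma arg_neg_fSphere {v : SphereX} (hv : v ∈ SSphere) :
    Complex.arg (-fSphere v) = Real.pi * v.1.2.2 := by
  obtain ⟨h₁, h₂⟩ := abs_lt.mp (abs_height_lt_one hv)
  rw [neg_fSphere, Complex.arg_exp_mul_I, toIocMod_eq_self]
  constructor <;> nlinarith [Real.pi_pos]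

lemma arg_neg_fSphere_div_pi {v : SphereX} (hv : v ∈ SSphere) :
    Complex.arg (-fSphere v) / Real.pi = v.1.2.2 := by
  rw [arg_neg_fSphere hv, mul_div_cancel_left₀ _ Real.pi_ne_zero]

lemma neg_fSphere_mem_slitPlane {v : SphereX} (hv : v ∈ SSphere) :
    -fSphere v ∈ Complex.slitPlane := by
  refine Complex.mem_slitPlane_iff_arg.mpr ⟨?_, ?_⟩
  · rw [arg_neg_fSphere hv]
    nlinarith [Real.pi_pos, (abs_lt.mp (abs_height_lt_one hv)).2]
  · rw [neg_fSphere]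
    exact Complex.exp_ne_zero _

lemma preimage_fSphere_one : fSphere ⁻¹' {1} = {northPole, southPole} := by
  ext v
  constructor
  · intro h
    by_contra hv
    have hS := neg_fSphere_mem_slitPlane (v := v) ⟨trivial, hv⟩
    rw [Set.mem_preimage, Set.mem_singleton_iff] at h
    norm_num [h, Complex.mem_slitPlane_iff] at hS
  · rintro (rfl | rfl)
    · simp only [Set.mem_preimage, Set.mem_singleton_iff, fSphere, northPole, Complex.ofReal_one]
      convert Complex.exp_two_pi_mul_I using 2
      ring
    · simp [fSphere, southPole]

lemma SSphere_eq_compl : SSphere = (fSphere ⁻¹' {1})ᶜ := by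
  rw [preimage_fSphere_one, SSphere, Set.compl_eq_univ_sdiff]

lemma SSphere_saturated : SSphere = fSphere ⁻¹' (fSphere '' SSphere) := by
  refine (Set.subset_preimage_image _ _).antisymm ?_
  rintro v ⟨w, hw, hwv⟩
  rw [SSphere_eq_compl] at hw ⊢
  simpa [← hwv] using hw

lemma isOpenMap_restrict_fSphere : IsOpenMap
    (Set.MapsTo.restrict fSphere SSphere (fSphere '' SSphere)
      (Set.mapsTo_image fSphere SSphere)) := by
  refine IsOpenMap.of_sections fun v => ?_
  obtain ⟨θ, hθ⟩ := exists_longitude v.1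
  let g : fSphere '' SSphere → SphereX := fun w =>
    sphericalPoint (θ, Real.arcsin (Complex.arg (-w.1) / Real.pi))
  have hfg (w : fSphere '' SSphere) : fSphere (g w) = w.1 := by
    obtain ⟨_, u, hu, rfl⟩ := w
    obtain ⟨h₁, h₂⟩ := abs_lt.mp (abs_height_lt_one hu)
    refine fSphere_congr ?_
    simp only [g, sphericalPoint, arg_neg_fSphere_div_pi hu, Real.sin_arcsin h₁.le h₂.le]
  have hgS (w : fSphere '' SSphere) : g w ∈ SSphere := by
    rw [SSphere_saturated, Set.mem_preimage, hfg]
    exact w.2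
  have hg : Continuous g := by
    refine continuous_sphericalPoint.comp (continuous_const.prodMk
      (Real.continuous_arcsin.comp (Continuous.div_const ?_ _)))
    refine continuous_iff_continuousAt.mpr fun w => ?_
    have hw : -w.1 ∈ Complex.slitPlane := by
      obtain ⟨_, u, hu, rfl⟩ := w
      exact neg_fSphere_mem_slitPlane hu
    exact ContinuousAt.comp' (Complex.continuousAt_arg hw)
      continuous_subtype_val.neg.continuousAt
  refine ⟨fun w => ⟨g w, hgS w⟩, (hg.subtype_mk hgS).continuousAt, Subtype.ext ?_,
    fun w => Subtype.ext (hfg w)⟩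
  simp only [g, Set.MapsTo.val_restrict_apply, arg_neg_fSphere_div_pi v.2, hθ]

lemma isConnected_fibre_fSphere {w : ℂ} (hw : w ∈ fSphere '' SSphere) :
    IsConnected (SSphere ∩ fSphere ⁻¹' {w}) := by
  obtain ⟨v, hv, rfl⟩ := hw
  convert isConnected_range (f := fun θ : ℝ => sphericalPoint (θ, Real.arcsin v.1.2.2))
    (continuous_sphericalPoint.comp (by fun_prop)) using 1
  ext u
  constructor
  · rintro ⟨hu, huv⟩
    obtain ⟨θ, hθ⟩ := exists_longitude u
    have h : u.1.2.2 = v.1.2.2 := by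
      rw [← arg_neg_fSphere_div_pi hu, ← arg_neg_fSphere_div_pi hv, Set.mem_singleton_iff.mp huv]
    exact ⟨θ, by rw [← h]; exact hθ⟩
  · rintro ⟨θ, rfl⟩
    obtain ⟨h₁, h₂⟩ := abs_lt.mp (abs_height_lt_one hv)
    have h : (sphericalPoint (θ, Real.arcsin v.1.2.2)).1.2.2 = v.1.2.2 :=
      Real.sin_arcsin h₁.le h₂.le
    refine ⟨?_, fSphere_congr h⟩
    rw [mem_SSphere_iff, h]
    exact mem_SSphere_iff.mp hv

/-- The image contains `I` and `-I` (at heights `-1/2` and `1/2`) but not their midpoint `0`. -/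
lemma not_convex_image_fSphere : ¬ Convex ℝ (fSphere '' SSphere) := by
  intro h
  have hz (s : ℝ) (hs : s ^ 2 = 1 / 4) :
      -Complex.exp ((Real.pi * s : ℝ) * Complex.I) ∈ fSphere '' SSphere := by
    let v : SphereX := ⟨(√(3 / 4), 0, s), by
      have h : √(3 / 4 : ℝ) ^ 2 = 3 / 4 := Real.sq_sqrt (by norm_num)
      simp only [SphereX, Set.mem_ofPred_eq, h, hs]
      norm_num⟩
    refine ⟨v, mem_SSphere_iff.mpr ?_, ?_⟩
    · norm_num [v, hs]
    · rw [← neg_fSphere v, neg_neg]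
  have hpos := hz (1 / 2) (by norm_num)
  have hneg := hz (-(1 / 2)) (by norm_num)
  have hI : ((Real.pi * (1 / 2) : ℝ) : ℂ) * Complex.I = Real.pi / 2 * Complex.I := by
    push_cast
    ring
  have hI' : ((Real.pi * -(1 / 2) : ℝ) : ℂ) * Complex.I = -Real.pi / 2 * Complex.I := by
    push_cast
    ring
  rw [hI, Complex.exp_pi_div_two_mul_I] at hpos
  rw [hI', Complex.exp_neg_pi_div_two_mul_I] at hneg
  obtain ⟨v, -, hv⟩ := h hpos hneg (by norm_num : (0 : ℝ) ≤ 1 / 2)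
    (by norm_num : (0 : ℝ) ≤ 1 / 2) (by norm_num)
  refine Complex.exp_ne_zero _ (hv.trans ?_)
  simp

lemma not_isConnected_preimage_fSphere_one : ¬ IsConnected (fSphere ⁻¹' {1}) := by
  rw [preimage_fSphere_one]
  intro h
  have hne : northPole ≠ southPole := fun h => by
    have : (1 : ℝ) = -1 := congrArg (fun v : SphereX => v.1.2.2) h
    norm_num at this
  exact h.isPreconnected.infinite_of_nontrivial (Set.nontrivial_pair hne) (Set.toFinite _)

/-- **Counterexample showing convexity of `f(S)` cannot be dropped.**
The map `f(x,y,z) = exp(πi(z+1))` on the unit sphere is continuous and proper, the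
complement of the poles `S` is dense and saturated by `f`, the corestriction
`f|_S : S → f(S)` is open and has connected fibres, yet `f(S)` is not convex and the
fibre `f⁻¹(1) = {(0,0,1), (0,0,-1)}` is not connected. -/
theorem sphere_example :
    (Continuous fSphere ∧ IsProperMap fSphere) ∧
    (Dense SSphere ∧ SSphere = fSphere ⁻¹' (fSphere '' SSphere)) ∧
    IsOpenMap
      (Set.MapsTo.restrict fSphere SSphere (fSphere '' SSphere)
        (Set.mapsTo_image fSphere SSphere)) ∧
    (∀ w ∈ fSphere '' SSphere, IsConnected (SSphere ∩ fSphere ⁻¹' {w})) ∧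
    ¬ Convex ℝ (fSphere '' SSphere) ∧
    (fSphere ⁻¹' {1} = {northPole, southPole} ∧ ¬ IsConnected (fSphere ⁻¹' {1})) := by
  exact ⟨⟨continuous_fSphere, continuous_fSphere.isProperMap⟩,
    ⟨dense_SSphere, SSphere_saturated⟩, isOpenMap_restrict_fSphere,
    fun _ => isConnected_fibre_fSphere, not_convex_image_fSphere, preimage_fSphere_one,
    not_isConnected_preimage_fSphere_one⟩
end

section
/- Let X = ([0,1] × [0,1]) \ ({1} × (0,1)) ⊆ ℝ² with the subspace topology, and let f : X → ℝ be the projection to the first coordinate, f(a,b) = a. Let S = [0,1) × [0,1] ⊆ X. Then: (i) f is continuous; (ii) S is dense in X and saturated by f, i.e. S = f⁻¹(f(S)); (iii) the corestricted map f|_S : S → f(S) is an open map with respect to the subspace topologies; (iv) for every t ∈ f(S) the fibre S ∩ f⁻¹({t}) is connected; but (v) f : X → ℝ is not a proper map, and (vi) the fibre f⁻¹({1}) = {(1,0), (1,1)} is not connected. -/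
/-- `X = ([0,1] × [0,1]) \ ({1} × (0,1)) ⊆ ℝ²`. -/
def Xsq : Set (ℝ × ℝ) :=
  (Set.Icc (0 : ℝ) 1 ×ˢ Set.Icc (0 : ℝ) 1) \ ({1} ×ˢ Set.Ioo (0 : ℝ) 1)

/-- Projection to the first coordinate. -/
def fProj : Xsq → ℝ := fun v => v.1.1

/-- `S = [0,1) × [0,1]` as a subset of `X`. -/
def Ssq : Set Xsq := {v | v.1 ∈ Set.Ico (0 : ℝ) 1 ×ˢ Set.Icc (0 : ℝ) 1}

/-- The point `(1,0)` of `X`. -/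
def ptA : Xsq := ⟨(1, 0), by norm_num [Xsq, Set.mem_prod, Prod.le_def]⟩

/-- The point `(1,1)` of `X`. -/
def ptB : Xsq := ⟨(1, 1), by norm_num [Xsq, Set.mem_prod, Prod.le_def]⟩

theorem mem_Xsq_of_mem_Ico_Icc {p : ℝ × ℝ} (hp : p ∈ Set.Ico (0 : ℝ) 1 ×ˢ Set.Icc (0 : ℝ) 1) :
    p ∈ Xsq :=
  ⟨⟨⟨hp.1.1, hp.1.2.le⟩, hp.2⟩, fun h => hp.1.2.ne h.1⟩

theorem image_val_Ssq :
    (Subtype.val '' Ssq : Set (ℝ × ℝ)) = Set.Ico (0 : ℝ) 1 ×ˢ Set.Icc (0 : ℝ) 1 := by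
  ext p
  constructor
  · rintro ⟨v, hv, rfl⟩
    exact hv
  · exact fun hp => ⟨⟨p, mem_Xsq_of_mem_Ico_Icc hp⟩, hp, rfl⟩

theorem closure_Ico_prod_Icc :
    closure (Set.Ico (0 : ℝ) 1 ×ˢ Set.Icc (0 : ℝ) 1) = Set.Icc (0 : ℝ) 1 ×ˢ Set.Icc (0 : ℝ) 1 := by
  rw [closure_prod_eq, closure_Ico zero_ne_one, closure_Icc]

theorem mem_Ssq_iff {v : Xsq} : v ∈ Ssq ↔ fProj v < 1 :=
  ⟨fun h => h.1.2, fun h => ⟨⟨v.2.1.1.1, h⟩, v.2.1.2⟩⟩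

theorem image_fProj_Ssq : fProj '' Ssq = Set.Ico (0 : ℝ) 1 := by
  ext t
  constructor
  · rintro ⟨v, hv, rfl⟩
    exact hv.1
  · intro ht
    have hp : (t, (0 : ℝ)) ∈ Set.Ico (0 : ℝ) 1 ×ˢ Set.Icc (0 : ℝ) 1 :=
      ⟨ht, le_rfl, zero_le_one⟩
    exact ⟨⟨_, mem_Xsq_of_mem_Ico_Icc hp⟩, hp, rfl⟩

theorem continuous_fProj : Continuous fProj :=
  continuous_fst.comp continuous_subtype_val

theorem dense_Ssq : Dense Ssq := fun v => by
  rw [closure_subtype, image_val_Ssq, closure_Ico_prod_Icc]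
  exact v.2.1

theorem Ssq_eq_preimage_image : Ssq = fProj ⁻¹' (fProj '' Ssq) := by
  refine (Set.subset_preimage_image _ _).antisymm ?_
  rintro v ⟨w, hw, hwv⟩
  rw [mem_Ssq_iff] at hw ⊢
  rwa [← hwv]

theorem isOpenMap_restrict_fProj :
    IsOpenMap
      (Set.MapsTo.restrict fProj Ssq (fProj '' Ssq) (Set.mapsTo_image fProj Ssq)) := by
  refine IsOpenMap.of_sections fun x => ?_
  have hmem (t : fProj '' Ssq) :
      ((t : ℝ), x.1.1.2) ∈ Set.Ico (0 : ℝ) 1 ×ˢ Set.Icc (0 : ℝ) 1 :=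
    ⟨image_fProj_Ssq ▸ t.2, x.2.2⟩
  refine ⟨fun t => ⟨⟨_, mem_Xsq_of_mem_Ico_Icc (hmem t)⟩, hmem t⟩, ?_, rfl, fun _ => rfl⟩
  exact Continuous.continuousAt <| Continuous.subtype_mk (Continuous.subtype_mk
    (continuous_subtype_val.prodMk continuous_const) _) _

theorem isConnected_Ssq_inter_fiber {t : ℝ} (ht : t ∈ fProj '' Ssq) :
    IsConnected (Ssq ∩ fProj ⁻¹' {t}) := by
  obtain ⟨w, hw, hwt⟩ := id ht
  refine ⟨⟨w, hw, hwt⟩, ?_⟩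
  rw [← Topology.IsInducing.subtypeVal.isPreconnected_image]
  have himage : (Subtype.val '' (Ssq ∩ fProj ⁻¹' {t}) : Set (ℝ × ℝ)) =
      {t} ×ˢ Set.Icc (0 : ℝ) 1 := by
    ext p
    constructor
    · rintro ⟨v, ⟨hv, hvt⟩, rfl⟩
      exact ⟨hvt, hv.2⟩
    · rintro ⟨hpt, hp⟩
      have hp' : p ∈ Set.Ico (0 : ℝ) 1 ×ˢ Set.Icc (0 : ℝ) 1 := by
        refine ⟨?_, hp⟩
        rw [Set.mem_singleton_iff.1 hpt, ← image_fProj_Ssq]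
        exact ht
      exact ⟨⟨p, mem_Xsq_of_mem_Ico_Icc hp'⟩, ⟨hp', hpt⟩, rfl⟩
  rw [himage]
  exact isPreconnected_singleton.prod isPreconnected_Icc

theorem not_isClosed_Xsq : ¬ IsClosed Xsq := fun h => by
  have hsub := h.closure_subset_iff.2 fun p hp => mem_Xsq_of_mem_Ico_Icc hp
  rw [closure_Ico_prod_Icc] at hsub
  have hmem : ((1 : ℝ), (1 / 2 : ℝ)) ∈ Xsq := hsub (by constructor <;> norm_num)
  exact hmem.2 (by constructor <;> norm_num)

theorem not_isProperMap_fProj : ¬ IsProperMap fProj := fun h => by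
  have hpre : fProj ⁻¹' Set.Icc 0 1 = Set.univ :=
    Set.eq_univ_of_forall fun v => v.2.1.1
  have hcompact := h.isCompact_preimage (isCompact_Icc (a := (0 : ℝ)) (b := 1))
  rw [hpre] at hcompact
  exact not_isClosed_Xsq (isCompact_iff_isCompact_univ.2 hcompact).isClosed

theorem fProj_preimage_one : fProj ⁻¹' {1} = {ptA, ptB} := by
  ext v
  constructor
  · intro hv
    have hv1 : v.1.1 = 1 := hv
    rcases v.2.1.2.1.eq_or_lt with h0 | h0
    · exact Or.inl (Subtype.ext (Prod.ext hv1 h0.symm))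
    · rcases v.2.1.2.2.eq_or_lt with h1 | h1
      · exact Or.inr (Subtype.ext (Prod.ext hv1 h1))
      · exact absurd ⟨hv1, h0, h1⟩ v.2.2
  · rintro (rfl | rfl) <;> rfl

theorem not_isConnected_fProj_preimage_one : ¬ IsConnected (fProj ⁻¹' {1}) := fun h => by
  rw [fProj_preimage_one] at h
  have himage := h.isPreconnected.image (fun v : Xsq => v.1.2)
    (continuous_snd.comp continuous_subtype_val).continuousOn
  rw [Set.image_pair] at himage
  have hmem : (1 / 2 : ℝ) ∈ ({0, 1} : Set ℝ) :=
    himage.Icc_subset (Or.inl rfl) (Or.inr rfl) (by constructor <;> norm_num [ptA, ptB])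
  norm_num at hmem

/-- **Counterexample showing properness cannot be dropped.**
On `X = ([0,1] × [0,1]) \ ({1} × (0,1))` the first-coordinate projection `f` is
continuous, `S = [0,1) × [0,1]` is dense and saturated by `f`, the corestriction
`f|_S : S → f(S)` is open and has connected fibres, yet `f` is not proper and the
fibre `f⁻¹(1) = {(1,0), (1,1)}` is not connected. -/
theorem square_example :
    Continuous fProj ∧
    (Dense Ssq ∧ Ssq = fProj ⁻¹' (fProj '' Ssq)) ∧
    IsOpenMap
      (Set.MapsTo.restrict fProj Ssq (fProj '' Ssq) (Set.mapsTo_image fProj Ssq)) ∧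
    (∀ t ∈ fProj '' Ssq, IsConnected (Ssq ∩ fProj ⁻¹' {t})) ∧
    ¬ IsProperMap fProj ∧
    (fProj ⁻¹' {1} = {ptA, ptB} ∧ ¬ IsConnected (fProj ⁻¹' {1})) := by
  exact ⟨continuous_fProj, ⟨dense_Ssq, Ssq_eq_preimage_image⟩, isOpenMap_restrict_fProj,
    fun _ => isConnected_Ssq_inter_fiber, not_isProperMap_fProj, fProj_preimage_one,
    not_isConnected_fProj_preimage_one⟩
end
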